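/- arXiv:2604.24632 — 2 statements merged into one kernel-verified Lean document; each statement's English description precedes it below -/
import Mathlib

section
/- Let X ∼ μ be a Borel probability measure on ℝ^d with E[X] = 0 and E‖X‖² < ∞. Set ν = μ * γ, τ₁ = E[‖X‖·1_{‖X‖>1}], τ₂ = (E[‖X‖²·1_{‖X‖>1}])^{1/2}, X̃ = X·1_{‖X‖≤1} − E[X·1_{‖X‖≤1}], and let ν̃ be the law of Z + X̃ for Z ∼ γ independent of X. Then W₁(ν, ν̃) ≤ τ₁ + min(1, τ₁) ≤ 2τ₁ and W₂(ν, ν̃) ≤ τ₂ + min(1, τ₂) ≤ 2τ₂. -/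
open MeasureTheory ProbabilityTheory Real ENNReal RealInnerProductSpace

noncomputable section

/-- The set of couplings of two measures `μ` and `ν`. -/
def couplings {E : Type*} [MeasurableSpace E] (μ ν : Measure E) : Set (Measure (E × E)) :=
  {τ | τ.map Prod.fst = μ ∧ τ.map Prod.snd = ν}

/-- The Wasserstein-`p` distance, valued in `ℝ≥0∞`:
`W_p(μ,ν) = (inf over couplings τ of ∫ ‖z₁ - z₂‖^p dτ)^{1/p}`. -/
noncomputable def Wp {E : Type*} [MeasurableSpace E] [NormedAddCommGroup E]
    (p : ℝ) (μ ν : Measure E) : ℝ≥0∞ :=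
  (⨅ τ ∈ couplings μ ν, ∫⁻ z : E × E, ENNReal.ofReal (‖z.1 - z.2‖ ^ p) ∂τ) ^ (1 / p)

/-- The standard Gaussian measure `N(0, I_d)` on `ℝ^d`. -/
noncomputable def stdGaussian (d : ℕ) : Measure (EuclideanSpace ℝ (Fin d)) :=
  (Measure.pi fun _ : Fin d => gaussianReal 0 1).map
    ((EuclideanSpace.equiv (Fin d) ℝ).symm : (Fin d → ℝ) → EuclideanSpace ℝ (Fin d))

/-- The Gaussian measure `N(m, I_d)` on `ℝ^d`. -/
noncomputable def gaussianE (d : ℕ) (m : EuclideanSpace ℝ (Fin d)) :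
    Measure (EuclideanSpace ℝ (Fin d)) :=
  (stdGaussian d).map (fun x => m + x)

/-- `C_p = (E_{ξ ∼ N(0,1)} |ξ|^p)^{1/p}`. -/
noncomputable def Cconst (p : ℝ) : ℝ := (∫ ξ : ℝ, |ξ| ^ p ∂(gaussianReal 0 1)) ^ (1 / p)

/-- `K_p = max {1, C_p/2 + 1/3}`. -/
noncomputable def Kconst (p : ℝ) : ℝ := max 1 (Cconst p / 2 + 1 / 3)

/-- The constant `c₄ = (e⁴ - 5)/16`. -/
noncomputable def cFour : ℝ := (Real.exp 4 - 5) / 16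

/-- The (second-moment) covariance matrix `∫ x xᵀ dμ` of a (centred) measure on `ℝ^d`. -/
noncomputable def covMat {d : ℕ} (μ : Measure (EuclideanSpace ℝ (Fin d))) :
    Matrix (Fin d) (Fin d) ℝ :=
  Matrix.of fun i j => ∫ x, x i * x j ∂μ

/-- The Frobenius norm of a matrix. -/
noncomputable def frob {d : ℕ} (A : Matrix (Fin d) (Fin d) ℝ) : ℝ :=
  Real.sqrt (∑ i, ∑ j, (A i j) ^ 2)

/-- `τ₁ = E[‖X‖ 1_{‖X‖ > 1}]`. -/
noncomputable def tailOne {d : ℕ} (μ : Measure (EuclideanSpace ℝ (Fin d))) : ℝ :=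
  ∫ x in {x : EuclideanSpace ℝ (Fin d) | 1 < ‖x‖}, ‖x‖ ∂μ

/-- `τ₂ = (E[‖X‖² 1_{‖X‖ > 1}])^{1/2}`. -/
noncomputable def tailTwo {d : ℕ} (μ : Measure (EuclideanSpace ℝ (Fin d))) : ℝ :=
  Real.sqrt (∫ x in {x : EuclideanSpace ℝ (Fin d) | 1 < ‖x‖}, ‖x‖ ^ 2 ∂μ)

/-- `m = E[X 1_{‖X‖ ≤ 1}]`. -/
noncomputable def truncMean {d : ℕ} (μ : Measure (EuclideanSpace ℝ (Fin d))) :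
    EuclideanSpace ℝ (Fin d) :=
  ∫ x in {x : EuclideanSpace ℝ (Fin d) | ‖x‖ ≤ 1}, x ∂μ

/-- `X̃ = X 1_{‖X‖ ≤ 1} - E[X 1_{‖X‖ ≤ 1}]`, as a function of `X`. -/
noncomputable def truncCentred {d : ℕ} (μ : Measure (EuclideanSpace ℝ (Fin d)))
    (x : EuclideanSpace ℝ (Fin d)) : EuclideanSpace ℝ (Fin d) :=
  (if ‖x‖ ≤ 1 then x else 0) - truncMean μ

/-- `Σ̃ = Cov(X̃) = E[X̃ X̃ᵀ]` (note `X̃` is centred). -/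
noncomputable def truncCov {d : ℕ} (μ : Measure (EuclideanSpace ℝ (Fin d))) :
    Matrix (Fin d) (Fin d) ℝ :=
  Matrix.of fun i j => ∫ x, truncCentred μ x i * truncCentred μ x j ∂μ

/-- The chi-squared divergence `χ²(ρ ‖ γ) = ∫ ((dρ/dγ) - 1)² dγ`. -/
noncomputable def chiSqDiv {E : Type*} [MeasurableSpace E] (ρ γm : Measure E) : ℝ :=
  ∫ x, ((ρ.rnDeriv γm x).toReal - 1) ^ 2 ∂γm

/-- The Kullback–Leibler divergence `KL(ρ ‖ γ) = ∫ log (dρ/dγ) dρ`. -/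
noncomputable def klDivReal {E : Type*} [MeasurableSpace E] (ρ γm : Measure E) : ℝ :=
  ∫ x, Real.log ((ρ.rnDeriv γm x).toReal) ∂ρ

/-- The Jacobian matrix `∇φ(x)` of a map `φ : ℝ^d → ℝ^d`, with entry `(i,j)` equal to
`∂φ_i/∂x_j (x)`. -/
noncomputable def jacobianM {d : ℕ}
    (φ : EuclideanSpace ℝ (Fin d) → EuclideanSpace ℝ (Fin d))
    (x : EuclideanSpace ℝ (Fin d)) : Matrix (Fin d) (Fin d) ℝ :=
  Matrix.of fun i j => fderiv ℝ φ x (EuclideanSpace.single j (1 : ℝ)) i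

/-- `τ` is a Stein kernel for the centred measure `ρ` relative to the standard Gaussian:
for all `φ ∈ C_c^∞(ℝ^d; ℝ^d)`, `E⟨X, φ(X)⟩ = E[tr(τ(X) ∇φ(X))]`. -/
def IsSteinKernel {d : ℕ} (ρ : Measure (EuclideanSpace ℝ (Fin d)))
    (τ : EuclideanSpace ℝ (Fin d) → Matrix (Fin d) (Fin d) ℝ) : Prop :=
  ∀ φ : EuclideanSpace ℝ (Fin d) → EuclideanSpace ℝ (Fin d),
    ContDiff ℝ (⊤ : ℕ∞) φ → HasCompactSupport φ →
      ∫ x, ⟪x, φ x⟫ ∂ρ = ∫ x, Matrix.trace (τ x * jacobianM φ x) ∂ρ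

/-- Adding independent noise of a common law does not increase the transport cost of a map `T`. -/
lemma Wp_conv_map_conv_le_eLpNorm {E : Type*} [NormedAddCommGroup E] [MeasurableSpace E]
    [BorelSpace E] [SecondCountableTopology E] {p : ℝ} (hp : 0 < p) (μ ρ : Measure E)
    [IsProbabilityMeasure μ] [IsProbabilityMeasure ρ] {T : E → E} (hT : Measurable T) :
    Wp p (μ ∗ ρ) (μ.map T ∗ ρ) ≤ eLpNorm (fun x => x - T x) (ENNReal.ofReal p) μ := by
  have hF : Measurable fun q : E × E => (q.1 + q.2, T q.1 + q.2) := by fun_prop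
  have hmem : (μ.prod ρ).map (fun q : E × E => (q.1 + q.2, T q.1 + q.2)) ∈
      couplings (μ ∗ ρ) (μ.map T ∗ ρ) := by
    constructor
    · rw [Measure.map_map measurable_fst hF]
      rfl
    · rw [Measure.map_map measurable_snd hF, Measure.conv]
      have h : (μ.map T).prod ρ = (μ.prod ρ).map (Prod.map T id) := by
        rw [← Measure.map_prod_map μ ρ hT measurable_id, Measure.map_id]
      rw [h, Measure.map_map (by fun_prop) (by fun_prop)]
      rfl
  rw [eLpNorm_eq_lintegral_rpow_enorm_toReal (by simpa using hp) ENNReal.ofReal_ne_top,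
    ENNReal.toReal_ofReal hp.le, Wp]
  refine ENNReal.rpow_le_rpow ((iInf₂_le _ hmem).trans_eq ?_) (by positivity)
  rw [lintegral_map (by fun_prop) hF]
  calc ∫⁻ q : E × E, ENNReal.ofReal (‖q.1 + q.2 - (T q.1 + q.2)‖ ^ p) ∂(μ.prod ρ)
      = ∫⁻ q : E × E, ‖q.1 - T q.1‖ₑ ^ p ∂(μ.prod ρ) := by
        refine lintegral_congr fun q => ?_
        rw [add_sub_add_right_eq_sub, ← ENNReal.ofReal_rpow_of_nonneg (norm_nonneg _) hp.le,
          ofReal_norm]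
    _ = ∫⁻ x, ‖x - T x‖ₑ ^ p ∂μ := by
        rw [lintegral_prod _ (by fun_prop)]
        simp

instance isProbabilityMeasure_stdGaussian (d : ℕ) :
    IsProbabilityMeasure (_root_.stdGaussian d) :=
  Measure.isProbabilityMeasure_map (by fun_prop)

section Truncation

variable {d : ℕ} {μ : Measure (EuclideanSpace ℝ (Fin d))}

lemma measurable_truncCentred : Measurable (truncCentred μ) :=
  (Measurable.ite (measurableSet_le measurable_norm measurable_const) measurable_id
    measurable_const).sub_const _

lemma measurableSet_one_lt_norm :
    MeasurableSet {x : EuclideanSpace ℝ (Fin d) | 1 < ‖x‖} :=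
  measurableSet_lt measurable_const measurable_norm

lemma sub_truncCentred (x : EuclideanSpace ℝ (Fin d)) :
    x - truncCentred μ x = {x | 1 < ‖x‖}.indicator id x + truncMean μ := by
  by_cases h : ‖x‖ ≤ 1
  · simp [truncCentred, h]
  · simp [truncCentred, h, not_le.1 h, sub_eq_add_neg]

lemma norm_truncMean_le_one [IsProbabilityMeasure μ] : ‖truncMean μ‖ ≤ 1 := by
  refine (norm_setIntegral_le_of_norm_le_const (measure_lt_top _ _)
    (fun x hx => hx)).trans ?_
  simpa using measureReal_le_one

lemma truncMean_eq_neg_integral_indicator (hmean : ∫ x, x ∂μ = 0)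
    (hint : Integrable (fun x => x) μ) :
    truncMean μ = -∫ x, {x | 1 < ‖x‖}.indicator id x ∂μ := by
  rw [integral_indicator measurableSet_one_lt_norm, eq_neg_iff_add_eq_zero, ← hmean,
    ← integral_add_compl measurableSet_one_lt_norm hint, add_comm]
  congr 2
  have : {x : EuclideanSpace ℝ (Fin d) | 1 < ‖x‖}ᶜ = {x | ‖x‖ ≤ 1} := by
    ext; simp
  rw [truncMean, this]

/-- The truncation error in `W_p`, in terms of the `L^p` norm of the tail. -/
lemma Wp_truncation_le [IsProbabilityMeasure μ] {p : ℝ} (hp : 1 ≤ p)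
    (ρ : Measure (EuclideanSpace ℝ (Fin d))) [IsProbabilityMeasure ρ]
    (hmean : ∫ x, x ∂μ = 0) (hint : Integrable (fun x => x) μ) {t : ℝ} (ht : 0 ≤ t)
    (htail : eLpNorm ({x : EuclideanSpace ℝ (Fin d) | 1 < ‖x‖}.indicator id)
      (ENNReal.ofReal p) μ = ENNReal.ofReal t) :
    Wp p (μ ∗ ρ) (μ.map (truncCentred μ) ∗ ρ) ≤ ENNReal.ofReal (t + min 1 t) := by
  have hp' : 1 ≤ ENNReal.ofReal p := by simpa using hp
  have hmeas : AEStronglyMeasurable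
      ({x : EuclideanSpace ℝ (Fin d) | 1 < ‖x‖}.indicator id) μ :=
    (measurable_id.indicator measurableSet_one_lt_norm).aestronglyMeasurable
  have hm : ‖truncMean μ‖ ≤ t := by
    rw [← ENNReal.ofReal_le_ofReal_iff ht, ofReal_norm, ← htail,
      truncMean_eq_neg_integral_indicator hmean hint, enorm_neg]
    refine (enorm_integral_le_lintegral_enorm _).trans ?_
    rw [← eLpNorm_one_eq_lintegral_enorm]
    exact eLpNorm_le_eLpNorm_of_exponent_le hp' hmeas
  refine (Wp_conv_map_conv_le_eLpNorm (by linarith) μ ρ measurable_truncCentred).trans ?_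
  simp_rw [sub_truncCentred]
  refine (eLpNorm_add_le hmeas aestronglyMeasurable_const hp').trans ?_
  rw [htail, eLpNorm_const _ (by positivity) (IsProbabilityMeasure.ne_zero μ),
    ENNReal.ofReal_add ht (by positivity), ← ofReal_norm, measure_univ, ENNReal.one_rpow, mul_one]
  gcongr
  exact le_min norm_truncMean_le_one hm

lemma tailOne_nonneg : 0 ≤ tailOne μ := integral_nonneg fun _ => norm_nonneg _

lemma eLpNorm_one_indicator_eq_tailOne (hint : Integrable (fun x => x) μ) :
    eLpNorm ({x : EuclideanSpace ℝ (Fin d) | 1 < ‖x‖}.indicator id) 1 μ =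
      ENNReal.ofReal (tailOne μ) := by
  rw [eLpNorm_indicator_eq_eLpNorm_restrict measurableSet_one_lt_norm,
    eLpNorm_one_eq_lintegral_enorm, tailOne,
    ofReal_integral_norm_eq_lintegral_enorm hint.restrict]
  rfl

lemma eLpNorm_two_indicator_eq_tailTwo (hmom : Integrable (fun x => ‖x‖ ^ 2) μ) :
    eLpNorm ({x : EuclideanSpace ℝ (Fin d) | 1 < ‖x‖}.indicator id) 2 μ =
      ENNReal.ofReal (tailTwo μ) := by
  rw [eLpNorm_indicator_eq_eLpNorm_restrict measurableSet_one_lt_norm,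
    eLpNorm_eq_lintegral_rpow_enorm_toReal (by simp) (by simp), tailTwo, Real.sqrt_eq_rpow,
    ← ENNReal.ofReal_rpow_of_nonneg (integral_nonneg fun _ => by positivity) (by norm_num),
    ofReal_integral_eq_lintegral_ofReal hmom.restrict (.of_forall fun _ => by positivity)]
  simp [ENNReal.ofReal_pow]

end Truncation

/-- truncation error bound in `W₁` and `W₂`. -/
theorem wasserstein_truncation_error
    (d : ℕ) (μ : Measure (EuclideanSpace ℝ (Fin d))) [IsProbabilityMeasure μ]
    (hmean : ∫ x, x ∂μ = 0)
    (hmom : Integrable (fun x => ‖x‖ ^ 2) μ) :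
    (Wp 1 (μ ∗ stdGaussian d) ((μ.map (truncCentred μ)) ∗ stdGaussian d) ≤
        ENNReal.ofReal (tailOne μ + min 1 (tailOne μ)) ∧
      tailOne μ + min 1 (tailOne μ) ≤ 2 * tailOne μ) ∧
    (Wp 2 (μ ∗ stdGaussian d) ((μ.map (truncCentred μ)) ∗ stdGaussian d) ≤
        ENNReal.ofReal (tailTwo μ + min 1 (tailTwo μ)) ∧
      tailTwo μ + min 1 (tailTwo μ) ≤ 2 * tailTwo μ) := by
  have hint : Integrable (fun x => x) μ :=
    ((memLp_two_iff_integrable_sq_norm aestronglyMeasurable_id).2 hmom).integrable one_le_two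
  refine ⟨⟨Wp_truncation_le le_rfl _ hmean hint tailOne_nonneg ?_, ?_⟩,
    Wp_truncation_le one_le_two _ hmean hint (Real.sqrt_nonneg _) ?_, ?_⟩
  · simpa using eLpNorm_one_indicator_eq_tailOne hint
  · linarith [min_le_right 1 (tailOne μ)]
  · simpa using eLpNorm_two_indicator_eq_tailTwo hmom
  · linarith [min_le_right 1 (tailTwo μ)]

end
end

section
/- Let X ∼ μ be a Borel probability measure on ℝ^d with E[X] = 0 and E‖X‖² < ∞. Set X̃ = X·1_{‖X‖≤1} − E[X·1_{‖X‖≤1}], let ν̃ be the law of Z + X̃ for Z ∼ γ independent of X, and let X̃′, X̃″ be i.i.d. copies of X̃. Then χ²(ν̃ ‖ γ) = E[exp(⟨X̃′, X̃″⟩)] − 1. -/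
open MeasureTheory ProbabilityTheory Real ENNReal RealInnerProductSpace

noncomputable section

lemma gaussianReal_eq_withDensity (a : ℝ) :
    gaussianReal a 1 =
      (gaussianReal 0 1).withDensity (fun x => ENNReal.ofReal (Real.exp (a * x - a ^ 2 / 2))) := by
  rw [gaussianReal_of_var_ne_zero a one_ne_zero, gaussianReal_of_var_ne_zero 0 one_ne_zero,
    ← withDensity_mul _ (measurable_gaussianPDF 0 1) (by fun_prop)]
  congr 1
  ext x
  rw [Pi.mul_apply]
  unfold gaussianPDF
  rw [← ENNReal.ofReal_mul (gaussianPDFReal_nonneg 0 1 x)]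
  unfold gaussianPDFReal
  rw [mul_assoc (√_)⁻¹, ← Real.exp_add]
  congr 3
  simp only [NNReal.coe_one]
  ring

lemma lintegral_pi_prod {ι : Type*} [Fintype ι] {E : ι → Type*} [∀ i, MeasurableSpace (E i)]
    (μ : ∀ i, Measure (E i)) [∀ i, IsProbabilityMeasure (μ i)] {f : ∀ i, E i → ℝ≥0∞}
    (hf : ∀ i, Measurable (f i)) :
    ∫⁻ x, ∏ i, f i (x i) ∂(Measure.pi μ) = ∏ i, ∫⁻ x, f i x ∂(μ i) := by
  have h : iIndepFun (fun i (x : ∀ i, E i) => f i (x i)) (Measure.pi μ) :=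
    iIndepFun_pi fun i => (hf i).aemeasurable
  rw [lintegral_prod_eq_prod_lintegral_of_indepFun Finset.univ _ h
    fun i => (hf i).comp (measurable_pi_apply i)]
  refine Finset.prod_congr rfl fun i _ => ?_
  exact (measurePreserving_eval μ i).lintegral_comp (hf i)

lemma pi_withDensity {ι : Type*} [Fintype ι] {E : ι → Type*} [∀ i, MeasurableSpace (E i)]
    (μ : ∀ i, Measure (E i)) [∀ i, IsProbabilityMeasure (μ i)] {f : ∀ i, E i → ℝ≥0∞}
    (hf : ∀ i, Measurable (f i)) [∀ i, SigmaFinite ((μ i).withDensity (f i))] :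
    Measure.pi (fun i => (μ i).withDensity (f i)) =
      (Measure.pi μ).withDensity (fun x => ∏ i, f i (x i)) := by
  refine (Measure.pi_eq fun s hs => ?_)
  rw [withDensity_apply _ (MeasurableSet.univ_pi hs),
    ← lintegral_indicator (MeasurableSet.univ_pi hs)]
  have : (Set.univ.pi s).indicator (fun x => ∏ i, f i (x i)) =
      fun x => ∏ i, (s i).indicator (f i) (x i) := by
    classical
    ext x
    by_cases hx : x ∈ Set.univ.pi s
    · rw [Set.indicator_of_mem hx]
      exact Finset.prod_congr rfl fun i _ =>
        (Set.indicator_of_mem (hx i (Set.mem_univ i)) _).symm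
    · rw [Set.indicator_of_notMem hx]
      simp only [Set.mem_univ_pi, not_forall] at hx
      obtain ⟨i, hi⟩ := hx
      exact (Finset.prod_eq_zero (Finset.mem_univ i) (Set.indicator_of_notMem hi _)).symm
  rw [this, lintegral_pi_prod μ fun i => (hf i).indicator (hs i)]
  refine Finset.prod_congr rfl fun i _ => ?_
  rw [lintegral_indicator (hs i), withDensity_apply _ (hs i)]

instance isProbabilityMeasure_stdGaussianE (d : ℕ) :
    IsProbabilityMeasure (_root_.stdGaussian d) := by
  unfold _root_.stdGaussian
  exact Measure.isProbabilityMeasure_map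
    (EuclideanSpace.equiv (Fin d) ℝ).symm.continuous.measurable.aemeasurable

/-- The density of `N(a, I_d)` with respect to `N(0, I_d)`. -/
def shiftDensity {d : ℕ} (a z : EuclideanSpace ℝ (Fin d)) : ℝ≥0∞ :=
  ENNReal.ofReal (Real.exp (⟪a, z⟫ - ‖a‖ ^ 2 / 2))

lemma measurable_shiftDensity {d : ℕ} :
    Measurable fun p : EuclideanSpace ℝ (Fin d) × EuclideanSpace ℝ (Fin d) =>
      shiftDensity p.1 p.2 := by
  unfold shiftDensity
  fun_prop

lemma shiftDensity_equiv_symm {d : ℕ} (a : EuclideanSpace ℝ (Fin d)) (x : Fin d → ℝ) :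
    shiftDensity a ((EuclideanSpace.equiv (Fin d) ℝ).symm x) =
      ∏ i, ENNReal.ofReal (Real.exp (a i * x i - a i ^ 2 / 2)) := by
  unfold shiftDensity
  rw [← ENNReal.ofReal_prod_of_nonneg fun i _ => (Real.exp_pos _).le, ← Real.exp_sum,
    Finset.sum_sub_distrib, ← Finset.sum_div, EuclideanSpace.real_norm_sq_eq, PiLp.inner_apply]
  simp [mul_comm]

/-- Translating the standard Gaussian amounts to reweighting it. -/
lemma lintegral_add_stdGaussian {d : ℕ} (a : EuclideanSpace ℝ (Fin d))
    {h : EuclideanSpace ℝ (Fin d) → ℝ≥0∞} (hh : Measurable h) :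
    ∫⁻ z, h (a + z) ∂(_root_.stdGaussian d) =
      ∫⁻ z, shiftDensity a z * h z ∂(_root_.stdGaussian d) := by
  set e := (EuclideanSpace.equiv (Fin d) ℝ).symm
  have he : Measurable e := e.continuous.measurable
  have hw : Measurable (shiftDensity a) := measurable_shiftDensity.of_uncurry_left
  have hwe : Measurable fun x => shiftDensity a (e x) := hw.comp he
  have hshift : (Measure.pi fun _ : Fin d => gaussianReal 0 1).map (fun x i => a i + x i) =
      (Measure.pi fun _ : Fin d => gaussianReal 0 1).withDensity
        (fun x => shiftDensity a (e x)) := by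
    have hprob (i : Fin d) : IsProbabilityMeasure ((gaussianReal 0 1).withDensity
        fun x => ENNReal.ofReal (Real.exp (a i * x - a i ^ 2 / 2))) := by
      rw [← gaussianReal_eq_withDensity]; infer_instance
    simp_rw [e, shiftDensity_equiv_symm]
    rw [← pi_withDensity (fun _ : Fin d => gaussianReal 0 1)
        (f := fun i x => ENNReal.ofReal (Real.exp (a i * x - a i ^ 2 / 2)))
        (fun i => by fun_prop)]
    simp_rw [← gaussianReal_eq_withDensity]
    rw [Measure.pi_map_pi (f := fun i x => a i + x) fun i => by fun_prop]
    simp [gaussianReal_map_const_add]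
  unfold _root_.stdGaussian
  rw [lintegral_map (by fun_prop) he,
    lintegral_map (f := fun z => shiftDensity a z * h z) (hw.mul hh) he]
  have := lintegral_withDensity_eq_lintegral_mul
    (Measure.pi fun _ : Fin d => gaussianReal 0 1) hwe (hh.comp he)
  simp only [Pi.mul_apply, Function.comp_apply] at this
  rw [← this, ← hshift, lintegral_map (f := fun x => h (e x)) (hh.comp he) (by fun_prop)]
  rfl

lemma conv_stdGaussian_eq_withDensity {d : ℕ} (α : Measure (EuclideanSpace ℝ (Fin d)))
    [SFinite α] :
    α ∗ _root_.stdGaussian d =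
      (_root_.stdGaussian d).withDensity (fun z => ∫⁻ a, shiftDensity a z ∂α) := by
  ext s hs
  have hi : Measurable (s.indicator (1 : EuclideanSpace ℝ (Fin d) → ℝ≥0∞)) :=
    measurable_one.indicator hs
  have hw : Measurable fun z : EuclideanSpace ℝ (Fin d) => ∫⁻ a, shiftDensity a z ∂α :=
    measurable_shiftDensity.lintegral_prod_left'
  rw [← lintegral_indicator_one hs, ← lintegral_indicator_one hs, Measure.lintegral_conv hi,
    lintegral_withDensity_eq_lintegral_mul _ hw hi]
  simp_rw [lintegral_add_stdGaussian _ hi]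
  rw [lintegral_lintegral_swap (measurable_shiftDensity.mul (hi.comp measurable_snd)).aemeasurable]
  refine lintegral_congr fun z => ?_
  exact lintegral_mul_const _ measurable_shiftDensity.of_uncurry_right

lemma lintegral_shiftDensity {d : ℕ} (a : EuclideanSpace ℝ (Fin d)) :
    ∫⁻ z, shiftDensity a z ∂(_root_.stdGaussian d) = 1 := by
  simpa using (lintegral_add_stdGaussian a (measurable_const (a := (1 : ℝ≥0∞)))).symm

lemma shiftDensity_mul_shiftDensity {d : ℕ} (a b z : EuclideanSpace ℝ (Fin d)) :
    shiftDensity a z * shiftDensity b z =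
      ENNReal.ofReal (Real.exp ⟪a, b⟫) * shiftDensity (a + b) z := by
  unfold shiftDensity
  rw [← ENNReal.ofReal_mul (Real.exp_pos _).le, ← ENNReal.ofReal_mul (Real.exp_pos _).le,
    ← Real.exp_add, ← Real.exp_add, inner_add_left, norm_add_sq_real]
  congr 2
  ring

lemma lintegral_shiftDensity_mul {d : ℕ} (a b : EuclideanSpace ℝ (Fin d)) :
    ∫⁻ z, shiftDensity a z * shiftDensity b z ∂(_root_.stdGaussian d) =
      ENNReal.ofReal (Real.exp ⟪a, b⟫) := by
  simp_rw [shiftDensity_mul_shiftDensity]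
  rw [lintegral_const_mul _ measurable_shiftDensity.of_uncurry_left, lintegral_shiftDensity,
    mul_one]

lemma lintegral_mixture_sq {d : ℕ} (α : Measure (EuclideanSpace ℝ (Fin d))) [SFinite α] :
    ∫⁻ z, (∫⁻ a, shiftDensity a z ∂α) ^ 2 ∂(_root_.stdGaussian d) =
      ∫⁻ a, ∫⁻ b, ENNReal.ofReal (Real.exp ⟪a, b⟫) ∂α ∂α := by
  have hl (z : EuclideanSpace ℝ (Fin d)) : Measurable fun a => shiftDensity a z :=
    measurable_shiftDensity.of_uncurry_right
  have hr (a : EuclideanSpace ℝ (Fin d)) : Measurable (shiftDensity a) :=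
    measurable_shiftDensity.of_uncurry_left
  have hw : Measurable fun z : EuclideanSpace ℝ (Fin d) => ∫⁻ a, shiftDensity a z ∂α :=
    measurable_shiftDensity.lintegral_prod_left'
  calc ∫⁻ z, (∫⁻ a, shiftDensity a z ∂α) ^ 2 ∂(_root_.stdGaussian d)
      = ∫⁻ z, ∫⁻ a, shiftDensity a z * ∫⁻ b, shiftDensity b z ∂α ∂α
          ∂(_root_.stdGaussian d) := by
        simp_rw [lintegral_mul_const _ (hl _), sq]
    _ = ∫⁻ a, ∫⁻ z, shiftDensity a z * ∫⁻ b, shiftDensity b z ∂α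
          ∂(_root_.stdGaussian d) ∂α :=
        lintegral_lintegral_swap
          ((measurable_shiftDensity.comp measurable_swap).mul
            (hw.comp measurable_fst)).aemeasurable
    _ = ∫⁻ a, ∫⁻ z, ∫⁻ b, shiftDensity a z * shiftDensity b z ∂α
          ∂(_root_.stdGaussian d) ∂α := by
        simp_rw [lintegral_const_mul _ (hl _)]
    _ = ∫⁻ a, ∫⁻ b, ∫⁻ z, shiftDensity a z * shiftDensity b z
          ∂(_root_.stdGaussian d) ∂α ∂α :=
        lintegral_congr fun a => lintegral_lintegral_swap
          (((hr a).comp measurable_fst).mul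
            (measurable_shiftDensity.comp measurable_swap)).aemeasurable
    _ = ∫⁻ a, ∫⁻ b, ENNReal.ofReal (Real.exp ⟪a, b⟫) ∂α ∂α := by
        simp_rw [lintegral_shiftDensity_mul]

lemma chiSqDiv_withDensity {E : Type*} [MeasurableSpace E] (γ : Measure E)
    [IsProbabilityMeasure γ] {F : E → ℝ≥0∞} (hF : Measurable F) (hF1 : ∫⁻ z, F z ∂γ = 1)
    (hF2 : ∫⁻ z, F z ^ 2 ∂γ ≠ ∞) :
    chiSqDiv (γ.withDensity F) γ = (∫⁻ z, F z ^ 2 ∂γ).toReal - 1 := by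
  have hfin : ∀ᵐ z ∂γ, F z < ∞ := ae_lt_top hF (by simp [hF1])
  have hfin2 : ∀ᵐ z ∂γ, F z ^ 2 < ∞ := hfin.mono fun z hz => ENNReal.pow_lt_top hz
  have h_int : Integrable (fun z => (F z).toReal) γ :=
    integrable_toReal_of_lintegral_ne_top hF.aemeasurable (by simp [hF1])
  have h_int_sq : Integrable (fun z => (F z ^ 2).toReal) γ :=
    integrable_toReal_of_lintegral_ne_top (hF.pow_const 2).aemeasurable hF2
  unfold chiSqDiv
  calc ∫ z, (((γ.withDensity F).rnDeriv γ z).toReal - 1) ^ 2 ∂γ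
      = ∫ z, ((F z ^ 2).toReal - 2 * (F z).toReal + 1) ∂γ := by
        refine integral_congr_ae ?_
        filter_upwards [Measure.rnDeriv_withDensity γ hF] with z hz
        rw [hz, ENNReal.toReal_pow]
        ring
    _ = (∫⁻ z, F z ^ 2 ∂γ).toReal - 1 := by
        rw [integral_add (by fun_prop) (integrable_const 1),
          integral_sub h_int_sq (h_int.const_mul 2), integral_const_mul,
          integral_toReal (hF.pow_const 2).aemeasurable hfin2,
          integral_toReal hF.aemeasurable hfin, hF1]
        simp
        ring

/-- The chi-squared divergence from `N(0, I_d)` of a Gaussian mixture with bounded mixing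
variable. -/
lemma chiSqDiv_map_conv_stdGaussian {d : ℕ} {Ω : Type*} [MeasurableSpace Ω] (P : Measure Ω)
    [IsProbabilityMeasure P] {T : Ω → EuclideanSpace ℝ (Fin d)} (hT : Measurable T) {C : ℝ}
    (hC : ∀ x, ‖T x‖ ≤ C) :
    chiSqDiv ((P.map T) ∗ _root_.stdGaussian d) (_root_.stdGaussian d) =
      (∫ x, ∫ y, Real.exp ⟪T x, T y⟫ ∂P ∂P) - 1 := by
  have := Measure.isProbabilityMeasure_map (μ := P) hT.aemeasurable
  have hw : Measurable fun z : EuclideanSpace ℝ (Fin d) => ∫⁻ a, shiftDensity a z ∂(P.map T) :=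
    measurable_shiftDensity.lintegral_prod_left'
  have hw1 : ∫⁻ z, ∫⁻ a, shiftDensity a z ∂(P.map T) ∂(_root_.stdGaussian d) = 1 := by
    rw [lintegral_lintegral_swap (f := fun z a => shiftDensity a z)
      (measurable_shiftDensity.comp measurable_swap).aemeasurable]
    simp [lintegral_shiftDensity]
  have hexp : Measurable fun p : EuclideanSpace ℝ (Fin d) × EuclideanSpace ℝ (Fin d) =>
      ENNReal.ofReal (Real.exp ⟪p.1, p.2⟫) := by fun_prop
  have hsq : ∫⁻ z, (∫⁻ a, shiftDensity a z ∂(P.map T)) ^ 2 ∂(_root_.stdGaussian d) =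
      ∫⁻ x, ∫⁻ y, ENNReal.ofReal (Real.exp ⟪T x, T y⟫) ∂P ∂P := by
    rw [lintegral_mixture_sq, lintegral_map hexp.lintegral_prod_right' hT]
    exact lintegral_congr fun x => lintegral_map (hexp.comp measurable_prodMk_left) hT
  have h_int : Integrable (fun p : Ω × Ω => Real.exp ⟪T p.1, T p.2⟫) (P.prod P) := by
    refine .of_bound (C := Real.exp (C * C)) (by fun_prop) (.of_forall fun p => ?_)
    rw [Real.norm_eq_abs, Real.abs_exp, Real.exp_le_exp]
    exact (real_inner_le_norm _ _).trans
      (mul_le_mul (hC _) (hC _) (norm_nonneg _) ((norm_nonneg _).trans (hC p.1)))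
  have hlint : ∫⁻ x, ∫⁻ y, ENNReal.ofReal (Real.exp ⟪T x, T y⟫) ∂P ∂P =
      ENNReal.ofReal (∫ x, ∫ y, Real.exp ⟪T x, T y⟫ ∂P ∂P) := by
    rw [integral_integral h_int, ofReal_integral_eq_lintegral_ofReal h_int
      (.of_forall fun p => (Real.exp_pos _).le), lintegral_prod _ (by fun_prop)]
  rw [conv_stdGaussian_eq_withDensity, chiSqDiv_withDensity _ hw hw1 (by simp [hsq, hlint]),
    hsq, hlint, ENNReal.toReal_ofReal]
  exact integral_nonneg fun x => integral_nonneg fun y => (Real.exp_pos _).le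

lemma measurable_truncCentred_s6 {d : ℕ} (μ : Measure (EuclideanSpace ℝ (Fin d))) :
    Measurable (truncCentred μ) :=
  (Measurable.ite (measurableSet_le measurable_norm measurable_const) measurable_id
    measurable_const).sub_const _

lemma norm_truncCentred_le {d : ℕ} (μ : Measure (EuclideanSpace ℝ (Fin d)))
    (x : EuclideanSpace ℝ (Fin d)) : ‖truncCentred μ x‖ ≤ 1 + ‖truncMean μ‖ := by
  refine (norm_sub_le _ _).trans (add_le_add_left ?_ _)
  split_ifs with h
  · exact h
  · simp

/-- chi-squared divergence of the smoothed truncated measure. -/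
theorem chiSq_truncated_convolution
    (d : ℕ) (μ : Measure (EuclideanSpace ℝ (Fin d))) [IsProbabilityMeasure μ]
    (hmean : ∫ x, x ∂μ = 0)
    (hmom : Integrable (fun x => ‖x‖ ^ 2) μ) :
    chiSqDiv ((μ.map (truncCentred μ)) ∗ stdGaussian d) (stdGaussian d) =
      (∫ x, ∫ y, Real.exp (⟪truncCentred μ x, truncCentred μ y⟫) ∂μ ∂μ) - 1 := by
  exact chiSqDiv_map_conv_stdGaussian μ (measurable_truncCentred_s6 μ) (norm_truncCentred_le μ)

end
end
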